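/- arXiv:2512.01064 — 6 statements merged into one kernel-verified Lean document; each statement's English description precedes it below -/
import Mathlib

section
/- Let t_0, ub ∈ [0, T] and assume all travel times are nonnegative. Let R be an elementary partial route with first vertex v and last vertex n+1 such that δm⁻¹(R) ≥ t_0. Suppose there exists an elementary partial route Q ≠ R with first vertex v and last vertex n+1 such that: δm(Q) < ub; V(Q) = V(R); δm⁻¹(Q) ≥ δm⁻¹(R); and at least one of the following holds: (1) δm⁻¹(Q) > δm⁻¹(R), or (2) δ(R, δm⁻¹(R)) = ub, or (3) δ(Q, δm⁻¹(Q)) < ub. Then R is ub-dominated by Q. -/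
noncomputable section

attribute [local instance] Classical.propDecidable

/-- `delta τ a r t i`: earliest arrival time at the `i`-th vertex of the partial route
`⟨r 0, …, r k⟩` when the vehicle departs from `r 0` at time `t`, taking waiting
times (lower time-window bounds `a`) into account. -/
def delta (τ : ℕ → ℕ → ℝ) (a : ℕ → ℝ) (r : ℕ → ℕ) (t : ℝ) : ℕ → ℝ
  | 0 => max t (a (r 0))
  | i + 1 => max (delta τ a r t i + τ (r i) (r (i + 1))) (a (r (i + 1)))

/-- The partial route `⟨r 0, …, r k⟩` is feasible for departure time `t`:
the departure is not before `a (r 0)` and every vertex is reached before the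
end `b` of its time window. -/
def Feasible (τ : ℕ → ℕ → ℝ) (a b : ℕ → ℝ) (r : ℕ → ℕ) (k : ℕ) (t : ℝ) : Prop :=
  a (r 0) ≤ t ∧ ∀ i ≤ k, delta τ a r t i ≤ b (r i)

/-- Arrival time of the partial route `⟨r 0, …, r k⟩` departing at time `t`,
with value `⊤ = ∞` when the route is not feasible for `t`. -/
def arrivalE (τ : ℕ → ℕ → ℝ) (a b : ℕ → ℝ) (r : ℕ → ℕ) (k : ℕ) (t : ℝ) : EReal :=
  if Feasible τ a b r k t then ((delta τ a r t k : ℝ) : EReal) else ⊤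

/-- `δm(R)`: earliest arrival time of `⟨r 0, …, r k⟩` when the vehicle leaves at
time `max t0 (a (r 0))` (`∞` if infeasible). -/
def deltaM (τ : ℕ → ℕ → ℝ) (a b : ℕ → ℝ) (t0 : ℝ) (r : ℕ → ℕ) (k : ℕ) : EReal :=
  arrivalE τ a b r k (max t0 (a (r 0)))

/-- An elementary route in the network with customers `1, …, n`: it starts at the
start depot `0`, ends at the end depot `n+1`, stays within the vertex set
`{0, …, n+1}`, and visits each vertex exactly once. -/
def ElemRoute (n : ℕ) (r : ℕ → ℕ) : Prop :=
  r 0 = 0 ∧ r (n + 1) = n + 1 ∧ (∀ i ≤ n + 1, r i ≤ n + 1) ∧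
    ∀ i ≤ n + 1, ∀ j ≤ n + 1, r i = r j → i = j

theorem delta_congr (τ : ℕ → ℕ → ℝ) (a : ℕ → ℝ) {r q : ℕ → ℕ} (t : ℝ) (i : ℕ)
    (h : ∀ j ≤ i, r j = q j) : delta τ a r t i = delta τ a q t i := by
  induction i with
  | zero => simp [delta, h 0 le_rfl]
  | succ i ih =>
    rw [delta, delta, ih fun j hj => h j (by omega), h i (by omega), h (i + 1) le_rfl]

theorem le_delta (τ : ℕ → ℕ → ℝ) (a : ℕ → ℝ) (r : ℕ → ℕ) (t : ℝ) (i : ℕ) :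
    a (r i) ≤ delta τ a r t i := by
  cases i <;> exact le_max_right _ _

theorem delta_mono (τ : ℕ → ℕ → ℝ) (a : ℕ → ℝ) (r : ℕ → ℕ) (i : ℕ) :
    Monotone fun t => delta τ a r t i := by
  intro s t hst
  induction i with
  | zero => exact max_le_max_right _ hst
  | succ i ih => exact max_le_max_right _ (add_le_add_left ih _)

theorem exists_delta_eq_max (τ : ℕ → ℕ → ℝ) (a : ℕ → ℝ) (r : ℕ → ℕ) (i : ℕ) :
    ∃ c w : ℝ, ∀ t, delta τ a r t i = max (t + c) w := by
  induction i with
  | zero => exact ⟨0, a (r 0), fun t => by simp [delta]⟩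
  | succ i ih =>
    obtain ⟨c, w, h⟩ := ih
    refine ⟨c + τ (r i) (r (i + 1)), max (w + τ (r i) (r (i + 1))) (a (r (i + 1))), fun t => ?_⟩
    rw [delta, h, max_add, max_assoc, add_assoc]

/-- If the arrival time is below `c` for some departure and at most `c` for departure `t`, then it
is below `c` for every departure before `t`. -/
theorem delta_lt_of_lt (τ : ℕ → ℕ → ℝ) (a : ℕ → ℝ) (r : ℕ → ℕ) (i : ℕ) {s t u c : ℝ}
    (hst : s < t) (ht : delta τ a r t i ≤ c) (hu : delta τ a r u i < c) :
    delta τ a r s i < c := by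
  obtain ⟨d, w, h⟩ := exists_delta_eq_max τ a r i
  rw [h, max_le_iff] at ht
  rw [h, max_lt_iff] at hu
  rw [h, max_lt_iff]
  exact ⟨by linarith, hu.2⟩

theorem delta_add (τ : ℕ → ℕ → ℝ) (a : ℕ → ℝ) (r : ℕ → ℕ) (t : ℝ) (s m : ℕ) :
    delta τ a r t (s + m) = delta τ a (fun j => r (s + j)) (delta τ a r t s) m := by
  induction m with
  | zero => exact (max_eq_left (le_delta τ a r t s)).symm
  | succ m ih => rw [← add_assoc, delta, ih, delta]; rfl

theorem arrivalE_lt_iff (τ : ℕ → ℕ → ℝ) (a b : ℕ → ℝ) (r : ℕ → ℕ) (k : ℕ) (t c : ℝ) :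
    arrivalE τ a b r k t < (c : EReal) ↔ Feasible τ a b r k t ∧ delta τ a r t k < c := by
  unfold arrivalE
  split_ifs with h <;> simp [h]

/-- The route following `r` before position `s`, and `q` from position `s` on. -/
def replaceSuffix (r q : ℕ → ℕ) (s i : ℕ) : ℕ :=
  if i < s then r i else q (i - s)

theorem replaceSuffix_of_lt (r q : ℕ → ℕ) {s i : ℕ} (h : i < s) :
    replaceSuffix r q s i = r i := if_pos h

theorem replaceSuffix_add (r q : ℕ → ℕ) (s m : ℕ) : replaceSuffix r q s (s + m) = q m := by
  simp [replaceSuffix]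

theorem ElemRoute.replaceSuffix {n s k : ℕ} {r q : ℕ → ℕ} (hr : ElemRoute n r)
    (hs : s + k = n + 1) (hq : ∀ i ≤ k, ∀ j ≤ k, q i = q j → i = j)
    (hlast : q k = n + 1) (hfirst : q 0 = r s)
    (hV : ∀ i ≤ k, ∃ j ≤ k, r (s + j) = q i) : ElemRoute n (replaceSuffix r q s) := by
  obtain ⟨h0, -, hle, hinj⟩ := hr
  have hne : ∀ i < s, ∀ m ≤ k, r i ≠ q m := by
    intro i hi m hm h
    obtain ⟨j, hj, hjm⟩ := hV m hm
    have := hinj i (by omega) (s + j) (by omega) (h.trans hjm.symm)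
    omega
  refine ⟨?_, ?_, fun i hi => ?_, fun i hi j hj hij => ?_⟩
  · rcases Nat.eq_zero_or_pos s with rfl | hpos
    · exact (replaceSuffix_add r q 0 0).trans (hfirst.trans h0)
    · rw [replaceSuffix_of_lt r q hpos, h0]
  · rw [← hs, replaceSuffix_add, hlast, hs]
  · rcases lt_or_ge i s with h | h
    · rw [replaceSuffix_of_lt r q h]; exact hle i hi
    · obtain ⟨m, rfl⟩ := Nat.exists_eq_add_of_le h
      obtain ⟨j, hj, hjm⟩ := hV m (by omega)
      rw [replaceSuffix_add, ← hjm]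
      exact hle _ (by omega)
  · rcases lt_or_ge i s with h | h <;> rcases lt_or_ge j s with h' | h'
    · rw [replaceSuffix_of_lt r q h, replaceSuffix_of_lt r q h'] at hij
      exact hinj i hi j hj hij
    · obtain ⟨m, rfl⟩ := Nat.exists_eq_add_of_le h'
      rw [replaceSuffix_of_lt r q h, replaceSuffix_add] at hij
      exact absurd hij (hne i h m (by omega))
    · obtain ⟨m, rfl⟩ := Nat.exists_eq_add_of_le h
      rw [replaceSuffix_of_lt r q h', replaceSuffix_add] at hij
      exact absurd hij.symm (hne j h' m (by omega))
    · obtain ⟨m, rfl⟩ := Nat.exists_eq_add_of_le h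
      obtain ⟨m', rfl⟩ := Nat.exists_eq_add_of_le h'
      rw [replaceSuffix_add, replaceSuffix_add] at hij
      rw [hq m (by omega) m' (by omega) hij]

/-- Proposition 1 (dominance rule): under the stated conditions, `R` is
`ub`-dominated by `Q`: every elementary route with suffix `R` either arrives
no earlier than `ub`, or there is an elementary route with suffix `Q`
arriving strictly earlier than `ub`. -/
theorem stmt0 (n : ℕ) (τ : ℕ → ℕ → ℝ) (a b : ℕ → ℝ) (T t0 ub : ℝ)
    (hτ : ∀ x y, 0 ≤ τ x y)
    (hab : ∀ x, a x ≤ b x) (hT : 0 ≤ T)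
    (hwin : ∀ x, 0 ≤ a x ∧ b x ≤ T)
    (hdep0 : a 0 = 0 ∧ b 0 = T) (hdepn : a (n + 1) = 0 ∧ b (n + 1) = T)
    (ht0 : t0 ∈ Set.Icc (0 : ℝ) T) (hub : ub ∈ Set.Icc (0 : ℝ) T)
    -- `R = ⟨r 0, …, r k⟩` and `Q = ⟨q 0, …, q k⟩` are elementary partial routes
    -- with the same first vertex, both ending at the end depot `n + 1`:
    (r q : ℕ → ℕ) (k : ℕ) (hk : k ≤ n + 1)
    (hrelem : ∀ i ≤ k, ∀ j ≤ k, r i = r j → i = j)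
    (hqelem : ∀ i ≤ k, ∀ j ≤ k, q i = q j → i = j)
    (hrlast : r k = n + 1) (hqlast : q k = n + 1) (hq0 : q 0 = r 0)
    -- `Q ≠ R`:
    (hQR : ∃ i ≤ k, q i ≠ r i)
    -- `V(Q) = V(R)`:
    (hV : ∀ x, (∃ i ≤ k, q i = x) ↔ ∃ i ≤ k, r i = x)
    -- `δm(Q) < ub`:
    (hQarr : deltaM τ a b t0 q k < (ub : EReal))
    -- `dR = δm⁻¹(R)` and `dQ = δm⁻¹(Q)` are the latest departure times within `[0, T]`
    -- for which the routes are feasible and arrive no later than `ub`: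
    (dR dQ : ℝ)
    (hdR : IsGreatest {t : ℝ | t ∈ Set.Icc 0 T ∧ Feasible τ a b r k t ∧
      delta τ a r t k ≤ ub} dR)
    (hdQ : IsGreatest {t : ℝ | t ∈ Set.Icc 0 T ∧ Feasible τ a b q k t ∧
      delta τ a q t k ≤ ub} dQ)
    -- `δm⁻¹(R) ≥ t0` and `δm⁻¹(Q) ≥ δm⁻¹(R)`:
    (hdRt0 : t0 ≤ dR) (hdRdQ : dR ≤ dQ)
    -- one of the three conditions holds:
    (hcase : dR < dQ ∨ delta τ a r dR k = ub ∨ delta τ a q dQ k < ub) :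
    ∀ r' : ℕ → ℕ, ElemRoute n r' → (∀ m ≤ k, r' (n + 1 - k + m) = r m) →
      (ub : EReal) ≤ deltaM τ a b t0 r' (n + 1) ∨
        ∃ q' : ℕ → ℕ, ElemRoute n q' ∧ (∀ m ≤ k, q' (n + 1 - k + m) = q m) ∧
          deltaM τ a b t0 q' (n + 1) < (ub : EReal) := by
  intro r' hr' hsuf
  refine or_iff_not_imp_left.2 fun hlt => ?_
  obtain ⟨s, hs⟩ := Nat.exists_eq_add_of_le' hk
  rw [show n + 1 - k = s by omega] at hsuf ⊢
  rw [not_le, deltaM, arrivalE_lt_iff] at hlt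
  rw [deltaM, arrivalE_lt_iff] at hQarr
  obtain ⟨⟨hst, hfeas⟩, harr⟩ := hlt
  set t := max t0 (a (r' 0)) with ht
  set x := delta τ a r' t s
  have hr's : r' s = r 0 := hsuf 0 (Nat.zero_le k)
  have hdr : ∀ m ≤ k, delta τ a r' t (s + m) = delta τ a r x m := fun m hm => by
    rw [delta_add]
    exact delta_congr τ a _ m fun j hj => hsuf j (hj.trans hm)
  have hax : a (r 0) ≤ x := hr's ▸ le_delta τ a r' t s
  have hxT : x ≤ T := (hfeas s (by omega)).trans (hwin _).2
  rw [hs, hdr k le_rfl] at harr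
  have hxR : x ≤ dR := hdR.2 ⟨⟨(hwin _).1.trans hax, hxT⟩, ⟨hax, fun m hm => by
    rw [← hdr m hm, ← hsuf m hm]; exact hfeas _ (by omega)⟩, harr.le⟩
  have hxQ : x ≤ dQ := hxR.trans hdRdQ
  obtain ⟨-, ⟨-, hQfeas⟩, hQub⟩ := hdQ.1
  have hqub : delta τ a q x k < ub := by
    by_cases h : x < dQ
    · exact delta_lt_of_lt τ a q k h hQub hQarr.2
    · obtain rfl : x = dR := le_antisymm hxR (by linarith)
      rcases hcase with h1 | h2 | h3
      · exact absurd h1 h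
      · exact absurd h2 harr.ne
      · exact (delta_mono τ a q k hdRdQ).trans_lt h3
  have hroute : ElemRoute n (replaceSuffix r' q s) :=
    hr'.replaceSuffix hs.symm hqelem hqlast (hq0.trans hr's.symm) fun i hi => by
      obtain ⟨j, hj, hji⟩ := (hV (q i)).1 ⟨i, hi, rfl⟩
      exact ⟨j, hj, (hsuf j hj).trans hji⟩
  have hhead : ∀ i ≤ s, replaceSuffix r' q s i = r' i := fun i hi => by
    rcases hi.lt_or_eq with h | rfl
    · exact replaceSuffix_of_lt r' q h
    · exact (replaceSuffix_add r' q i 0).trans (hq0.trans hr's.symm)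
  have hdpre : ∀ i ≤ s, delta τ a (replaceSuffix r' q s) t i = delta τ a r' t i := fun i hi =>
    delta_congr τ a t i fun j hj => hhead j (hj.trans hi)
  have hdq : ∀ m, delta τ a (replaceSuffix r' q s) t (s + m) = delta τ a q x m := fun m => by
    rw [delta_add, hdpre s le_rfl]
    exact delta_congr τ a _ m fun j _ => replaceSuffix_add r' q s j
  refine ⟨replaceSuffix r' q s, hroute, fun m _ => replaceSuffix_add r' q s m, ?_⟩
  rw [deltaM, arrivalE_lt_iff, hhead 0 (Nat.zero_le s), ← ht]
  refine ⟨⟨?_, fun i hi => ?_⟩, ?_⟩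
  · rw [hhead 0 (Nat.zero_le s)]; exact hst
  · rcases le_or_gt i s with h | h
    · rw [hdpre i h, hhead i h]; exact hfeas i hi
    · obtain ⟨m, rfl⟩ := Nat.exists_eq_add_of_le h.le
      rw [hdq, replaceSuffix_add]
      exact (delta_mono τ a q m hxQ).trans (hQfeas m (by omega))
  · rw [hs, hdq]; exact hqub
end
end

section
/- Let R be a partial route with first vertex v_0 and let S = {t ∈ [0, T] : R is feasible for t}. Then either S is empty, or S is the closed interval [a(v_0), t_max] for some t_max with a(v_0) ≤ t_max ≤ min{b(v_0), T}; in particular, whenever S is nonempty it contains a(v_0) and has a maximum element. -/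
noncomputable section

attribute [local instance] Classical.propDecidable

theorem continuous_delta (τ : ℕ → ℕ → ℝ) (a : ℕ → ℝ) (r : ℕ → ℕ) (i : ℕ) :
    Continuous fun t => delta τ a r t i := by
  induction i with
  | zero => exact continuous_id.max continuous_const
  | succ i ih => exact (ih.add continuous_const).max continuous_const

theorem isClosed_setOf_feasible (τ : ℕ → ℕ → ℝ) (a b : ℕ → ℝ) (r : ℕ → ℕ) (k : ℕ) :
    IsClosed {t | Feasible τ a b r k t} := by
  simp only [Feasible, Set.ofPred_and, Set.ofPred_forall]
  exact isClosed_Ici.inter <| isClosed_iInter fun i => isClosed_iInter fun _ =>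
    isClosed_le (continuous_delta τ a r i) continuous_const

theorem Feasible.le_upper {τ : ℕ → ℕ → ℝ} {a b : ℕ → ℝ} {r : ℕ → ℕ} {k : ℕ} {t : ℝ}
    (h : Feasible τ a b r k t) : t ≤ b (r 0) :=
  (le_max_left _ _).trans (h.2 0 k.zero_le)

theorem Feasible.anti {τ : ℕ → ℕ → ℝ} {a b : ℕ → ℝ} {r : ℕ → ℕ} {k : ℕ} {s t : ℝ}
    (h : Feasible τ a b r k t) (has : a (r 0) ≤ s) (hst : s ≤ t) : Feasible τ a b r k s :=
  ⟨has, fun i hi => (delta_mono τ a r i hst).trans (h.2 i hi)⟩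

/-- The set `S` of feasible departure times within the horizon is either empty or a
closed interval `[a (r 0), tmax]` with `a (r 0) ≤ tmax ≤ min (b (r 0)) T`;
in particular, when nonempty it contains `a (r 0)` and has a maximum element. -/
theorem stmt4 (τ : ℕ → ℕ → ℝ) (a b : ℕ → ℝ) (T : ℝ)
    (hab : ∀ x, a x ≤ b x) (hT : 0 ≤ T) (hwin : ∀ x, 0 ≤ a x ∧ b x ≤ T)
    (r : ℕ → ℕ) (k : ℕ) :
    {t : ℝ | t ∈ Set.Icc 0 T ∧ Feasible τ a b r k t} = ∅ ∨
      ∃ tmax : ℝ, a (r 0) ≤ tmax ∧ tmax ≤ min (b (r 0)) T ∧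
        {t : ℝ | t ∈ Set.Icc 0 T ∧ Feasible τ a b r k t} = Set.Icc (a (r 0)) tmax := by
  rcases Set.eq_empty_or_nonempty {t : ℝ | t ∈ Set.Icc 0 T ∧ Feasible τ a b r k t} with h | h
  · exact Or.inl h
  · have hcompact : IsCompact {t : ℝ | t ∈ Set.Icc 0 T ∧ Feasible τ a b r k t} :=
      isCompact_Icc.inter_right (isClosed_setOf_feasible τ a b r k)
    obtain ⟨m, ⟨hmT, hm⟩, hmax⟩ := hcompact.exists_isGreatest h
    refine Or.inr ⟨m, hm.1, le_min hm.le_upper hmT.2, Set.Subset.antisymm ?_ ?_⟩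
    · exact fun t ht => ⟨ht.2.1, hmax ht⟩
    · exact fun t ht =>
        ⟨⟨(hwin _).1.trans ht.1, ht.2.trans hmT.2⟩, hm.anti ht.1 ht.2⟩
end
end

section
/- Let R be a partial route and suppose the set S = {t ∈ [0, T] : R is feasible for t} is nonempty, so that S has a maximum element t_max. Then δ(R, t) − t ≥ δ(R, t_max) − t_max for every t ∈ S; consequently the duration Δ(R) = min{δ(R, t) − t : t ∈ S} is well defined and attained at the latest feasible departure time t_max, i.e., Δ(R) = δ(R, t_max) − t_max. -/
noncomputable section

attribute [local instance] Classical.propDecidable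

/-- Departing later by `t - s` delays the arrival by at most `t - s`. -/
theorem delta_sub_le_delta_sub (τ : ℕ → ℕ → ℝ) (a : ℕ → ℝ) (r : ℕ → ℕ) {s t : ℝ} (h : s ≤ t)
    (hs : a (r 0) ≤ s) (i : ℕ) : delta τ a r t i - t ≤ delta τ a r s i - s := by
  induction i with
  | zero => simp [delta, hs, hs.trans h]
  | succ i ih =>
    simp only [delta]
    grind

/-- If `tmax` is the maximum of the set `S` of feasible departure times within the
horizon, then `δ(R, t) − t ≥ δ(R, tmax) − tmax` for every `t ∈ S`; consequently the
duration `Δ(R) = min {δ(R, t) − t : t ∈ S}` is well defined and attained at `tmax`. -/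
theorem stmt5 (τ : ℕ → ℕ → ℝ) (a b : ℕ → ℝ) (T : ℝ) (r : ℕ → ℕ) (k : ℕ) (tmax : ℝ)
    (htm : IsGreatest {t : ℝ | t ∈ Set.Icc 0 T ∧ Feasible τ a b r k t} tmax) :
    (∀ t ∈ {t : ℝ | t ∈ Set.Icc 0 T ∧ Feasible τ a b r k t},
        delta τ a r tmax k - tmax ≤ delta τ a r t k - t) ∧
      IsLeast ((fun t => delta τ a r t k - t) ''
          {t : ℝ | t ∈ Set.Icc 0 T ∧ Feasible τ a b r k t})
        (delta τ a r tmax k - tmax) := by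
  have hle : ∀ t ∈ {t : ℝ | t ∈ Set.Icc 0 T ∧ Feasible τ a b r k t},
      delta τ a r tmax k - tmax ≤ delta τ a r t k - t := fun t ht =>
    delta_sub_le_delta_sub τ a r (htm.2 ht) ht.2.1 k
  exact ⟨hle, Set.mem_image_of_mem _ htm.1, Set.forall_mem_image.2 hle⟩
end
end

section
/- Let R = ⟨v_0, …, v_k⟩ be a partial route that is feasible for t, and suppose v_i = w and v_j = v for some indices i < j. Then δ(R, t, j) ≥ EAT(w, v); that is, any feasible partial route that visits w before v arrives at v no earlier than the earliest arrival time at v after visiting w. -/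
noncomputable section

attribute [local instance] Classical.propDecidable

/-- `EAT w v`: earliest arrival time at `v` after visiting `w`, i.e. the infimum of
the arrival times `delta τ a u (a w) k` over all partial routes `u` starting at `w`,
ending at `v`, and feasible for departure time `a w` (`⊤ = ∞` if no such route exists). -/
def EAT (τ : ℕ → ℕ → ℝ) (a b : ℕ → ℝ) (w v : ℕ) : EReal :=
  sInf {x : EReal | ∃ (u : ℕ → ℕ) (k : ℕ), u 0 = w ∧ u k = v ∧
    Feasible τ a b u k (a w) ∧ x = ((delta τ a u (a w) k : ℝ) : EReal)}

/-- Departing from the `i`-th vertex no later than a route arrives there and following its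
tail, every later vertex is reached no later than along the whole route. -/
theorem delta_tail_le (τ : ℕ → ℕ → ℝ) (a : ℕ → ℝ) (r : ℕ → ℕ) (s t : ℝ) (i : ℕ)
    (hs : s ≤ delta τ a r t i) (m : ℕ) :
    delta τ a (fun l => r (i + l)) s m ≤ delta τ a r t (i + m) := by
  induction m with
  | zero => exact max_le hs (le_delta τ a r t i)
  | succ m ih => exact max_le_max_right _ (add_le_add_left ih _)

/-- Any feasible partial route that visits `w` (at position `i`) strictly before `v`
(at position `j`) arrives at `v` no earlier than the earliest arrival time
`EAT w v` at `v` after visiting `w`. -/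
theorem stmt9 (τ : ℕ → ℕ → ℝ) (a b : ℕ → ℝ) (r : ℕ → ℕ) (k : ℕ) (t : ℝ)
    (hf : Feasible τ a b r k t) (i j : ℕ) (hij : i < j) (hjk : j ≤ k)
    (w v : ℕ) (hw : r i = w) (hv : r j = v) :
    EAT τ a b w v ≤ ((delta τ a r t j : ℝ) : EReal) := by
  have tail_le := delta_tail_le τ a r (a (r i)) t i (le_delta τ a r t i)
  have hadd : i + (j - i) = j := Nat.add_sub_cancel' hij.le
  have hfeas : Feasible τ a b (fun l => r (i + l)) (j - i) (a w) := by
    subst hw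
    exact ⟨le_rfl, fun l hl => (tail_le l).trans (hf.2 (i + l) (by omega))⟩
  have hEAT : EAT τ a b w v ≤ (delta τ a (fun l => r (i + l)) (a w) (j - i) : EReal) :=
    sInf_le ⟨fun l => r (i + l), j - i, hw, (congrArg r hadd).trans hv, hfeas, rfl⟩
  refine hEAT.trans (EReal.coe_le_coe_iff.2 ?_)
  subst hw
  simpa only [hadd] using tail_le (j - i)
end
end

section
/- Let R = ⟨v_0, …, v_k⟩ be a partial route that is feasible for t ∈ [0, T], and suppose v_i = w and v_j = v for some indices i < j. Then δ(R, t, i) ≤ LDT(w, v); that is, any feasible partial route that visits w before v departs from w no later than the latest departure time from w before visiting v. -/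
noncomputable section

attribute [local instance] Classical.propDecidable

/-- `LDT T w v`: latest departure time from `w` before visiting `v`, i.e. the supremum
of all times `t ∈ [0, T]` for which some partial route starting at `w` and ending at `v`
is feasible (`⊥ = -∞` if no such time exists). -/
def LDT (τ : ℕ → ℕ → ℝ) (a b : ℕ → ℝ) (T : ℝ) (w v : ℕ) : EReal :=
  sSup {x : EReal | ∃ t : ℝ, x = (t : EReal) ∧ t ∈ Set.Icc 0 T ∧
    ∃ (u : ℕ → ℕ) (k : ℕ), u 0 = w ∧ u k = v ∧ Feasible τ a b u k t}

/-- Restarting a route at its `i`-th vertex, at the time that vertex is reached, does not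
change the later arrival times. -/
theorem delta_shift (τ : ℕ → ℕ → ℝ) (a : ℕ → ℝ) (r : ℕ → ℕ) (t : ℝ) (i m : ℕ) :
    delta τ a (fun n => r (i + n)) (delta τ a r t i) m = delta τ a r t (i + m) := by
  induction m with
  | zero => exact max_eq_left (le_delta τ a r t i)
  | succ m ih =>
    rw [delta, ih, ← Nat.add_assoc, delta, Nat.add_assoc]

/-- The part of a feasible route after its `i`-th vertex is feasible for the time that
vertex is reached. -/
theorem Feasible.shift {τ : ℕ → ℕ → ℝ} {a b : ℕ → ℝ} {r : ℕ → ℕ} {k : ℕ} {t : ℝ}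
    (hf : Feasible τ a b r k t) {i m : ℕ} (him : i + m ≤ k) :
    Feasible τ a b (fun n => r (i + n)) m (delta τ a r t i) := by
  refine ⟨le_delta τ a r t i, fun n hn => ?_⟩
  rw [delta_shift]
  exact hf.2 (i + n) (by omega)

/-- Any partial route feasible for some `t ∈ [0, T]` that visits `w` (at position `i`)
strictly before `v` (at position `j`) departs from `w` no later than the latest
departure time `LDT w v` from `w` before visiting `v`. -/
theorem stmt10 (τ : ℕ → ℕ → ℝ) (a b : ℕ → ℝ) (T : ℝ)
    (hab : ∀ x, a x ≤ b x) (hT : 0 ≤ T) (hwin : ∀ x, 0 ≤ a x ∧ b x ≤ T)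
    (r : ℕ → ℕ) (k : ℕ) (t : ℝ) (htT : t ∈ Set.Icc (0 : ℝ) T)
    (hf : Feasible τ a b r k t) (i j : ℕ) (hij : i < j) (hjk : j ≤ k)
    (w v : ℕ) (hw : r i = w) (hv : r j = v) :
    ((delta τ a r t i : ℝ) : EReal) ≤ LDT τ a b T w v := by
  refine le_sSup ⟨_, rfl, ⟨?_, ?_⟩, fun n => r (i + n), j - i, hw, ?_, hf.shift (by omega)⟩
  · exact (hwin _).1.trans (le_delta τ a r t i)
  · exact (hf.2 i (by omega)).trans (hwin _).2
  · simpa [Nat.add_sub_cancel' hij.le] using hv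
end
end

section
/- Let v and w be vertices with EAT(w, v) = ∞, i.e., no partial route starting at w and ending at v is feasible for a(w). Then no partial route that is feasible for some t ∈ ℝ visits w strictly before v: there is no feasible partial route ⟨v_0, …, v_k⟩ with v_i = w and v_j = v for indices i < j. -/
noncomputable section

attribute [local instance] Classical.propDecidable

/-- Starting a route afresh at its `i`-th vertex, at the opening of that vertex's time window,
never leads to later arrivals. -/
theorem delta_shift_le (τ : ℕ → ℕ → ℝ) (a : ℕ → ℝ) (r : ℕ → ℕ) (t : ℝ) (i m : ℕ) :
    delta τ a (fun n => r (i + n)) (a (r i)) m ≤ delta τ a r t (i + m) := by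
  induction m with
  | zero => simpa [delta] using le_delta τ a r t i
  | succ m ih => exact max_le_max (add_le_add ih le_rfl) le_rfl

/-- If `EAT w v = ∞`, i.e. no partial route starting at `w` and ending at `v` is
feasible for `a w`, then no partial route feasible for some `t ∈ ℝ` visits `w`
strictly before `v`. -/
theorem stmt11 (τ : ℕ → ℕ → ℝ) (a b : ℕ → ℝ) (w v : ℕ)
    (hEAT : EAT τ a b w v = ⊤) :
    ¬ ∃ (r : ℕ → ℕ) (k : ℕ) (t : ℝ) (i j : ℕ),
      i < j ∧ j ≤ k ∧ r i = w ∧ r j = v ∧ Feasible τ a b r k t := by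
  rintro ⟨r, k, t, i, j, hij, hjk, rfl, rfl, -, hr⟩
  have hle : EAT τ a b (r i) (r j) ≤
      ((delta τ a (fun n => r (i + n)) (a (r i)) (j - i) : ℝ) : EReal) := by
    refine sInf_le ⟨fun n => r (i + n), j - i, rfl, ?_, ⟨le_rfl, fun m hm => ?_⟩, rfl⟩
    · exact congrArg r (by omega)
    · exact (delta_shift_le τ a r t i m).trans (hr (i + m) (by omega))
  rw [hEAT, top_le_iff] at hle
  exact EReal.coe_ne_top _ hle
end
end
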